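/- arXiv:2010.15801 — 8 statements merged into one kernel-verified Lean document; each statement's English description precedes it below -/
import Mathlib

section
/- Let T > 0. Let σ : ℝ → ℝ be continuous on [0,T] with σ(t) > 0 for all t ∈ [0,T), σ(T) = 0, and σ(t) ≤ T − t for all t ∈ [0,T]. Let σ' : ℝ → ℝ satisfy 0 < σ'(t) ≤ σ(t) for all t ∈ [0,T) and σ'(T) = 0, and suppose that for every sequence (s_n) in [0,T], if σ'(s_n) → 0 then σ(s_n) → 0. Define the ray-marching sequence t₀ = 0 and t_{n+1} = t_n + σ'(t_n). Then the sequence (t_n) converges to T. -/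
/-- Ray-marching with a distance underestimator converges to the first hitting
parameter `T` along an arc-length parametrized ray. -/
theorem raymarch_underestimator_converges
    (T : ℝ) (hT : 0 < T) (σ σ' : ℝ → ℝ)
    (hσcont : ContinuousOn σ (Set.Icc 0 T))
    (hσpos : ∀ t ∈ Set.Ico 0 T, 0 < σ t)
    (hσT : σ T = 0)
    (hσle : ∀ t ∈ Set.Icc 0 T, σ t ≤ T - t)
    (hσ'pos : ∀ t ∈ Set.Ico 0 T, 0 < σ' t)
    (hσ'le : ∀ t ∈ Set.Ico 0 T, σ' t ≤ σ t)
    (hσ'T : σ' T = 0)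
    (hseq : ∀ s : ℕ → ℝ, (∀ n, s n ∈ Set.Icc 0 T) →
      Filter.Tendsto (fun n => σ' (s n)) Filter.atTop (nhds 0) →
      Filter.Tendsto (fun n => σ (s n)) Filter.atTop (nhds 0))
    (t : ℕ → ℝ) (ht0 : t 0 = 0) (hrec : ∀ n, t (n + 1) = t n + σ' (t n)) :
    Filter.Tendsto t Filter.atTop (nhds T) := by
  have hmem : ∀ n, t n ∈ Set.Icc 0 T := by
    intro n
    induction n with
    | zero => simp [ht0, hT.le]
    | succ n ih =>
      rw [hrec]
      rcases ih.2.eq_or_lt with h | h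
      · simp [h, hσ'T, hT.le]
      · have hpos := hσ'pos _ ⟨ih.1, h⟩
        have hle := hσ'le _ ⟨ih.1, h⟩
        have hdist := hσle _ ih
        exact ⟨by linarith [ih.1], by linarith⟩
  have hmono : Monotone t := monotone_nat_of_le_succ fun n => by
    rw [hrec]
    rcases (hmem n).2.eq_or_lt with h | h
    · simp [h, hσ'T]
    · linarith [hσ'pos _ ⟨(hmem n).1, h⟩]
  have hbdd : BddAbove (Set.range t) := ⟨T, by rintro _ ⟨n, rfl⟩; exact (hmem n).2⟩
  obtain ⟨L, hL⟩ : ∃ L, Filter.Tendsto t Filter.atTop (nhds L) :=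
    ⟨_, tendsto_atTop_ciSup hmono hbdd⟩
  have hLmem : L ∈ Set.Icc 0 T :=
    isClosed_Icc.mem_of_tendsto hL (Filter.Eventually.of_forall hmem)
  have hstep : Filter.Tendsto (fun n => σ' (t n)) Filter.atTop (nhds 0) := by
    simpa [hrec] using ((Filter.tendsto_add_atTop_iff_nat 1).2 hL).sub hL
  have hσL : Filter.Tendsto (fun n => σ (t n)) Filter.atTop (nhds (σ L)) :=
    (hσcont L hLmem).tendsto.comp
      (tendsto_nhdsWithin_iff.2 ⟨hL, Filter.Eventually.of_forall hmem⟩)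
  have hzero : σ L = 0 := tendsto_nhds_unique hσL (hseq t hmem hstep)
  rcases hLmem.2.eq_or_lt with h | h
  · exact h ▸ hL
  · exact absurd hzero (hσpos L ⟨hLmem.1, h⟩).ne'
end

section
/- Let a, c, α ∈ ℝ with c ≠ 0. Define x(t) = (2a/c)·sin(c·t/2)·cos(c·t/2 + α), y(t) = (2a/c)·sin(c·t/2)·sin(c·t/2 + α), z(t) = c·t + (a²/(2c²))·(c·t − sin(c·t)), and u_x(t) = a·cos(c·t + α), u_y(t) = a·sin(c·t + α), u_z(t) = c. Then for every t ∈ ℝ: x has derivative u_x(t) at t, y has derivative u_y(t) at t, and z has derivative u_z(t) + (1/2)·(x(t)·u_y(t) − y(t)·u_x(t)) at t. Moreover x(0) = y(0) = z(0) = 0. -/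
/-- The closed-form solution of the geodesic flow of Nil (case `c ≠ 0`):
the path `(x, y, z)` solves `ẋ = uₓ, ẏ = u_y, ż = u_z + ½(x u_y − y uₓ)`
with `(x,y,z)(0) = 0`, where `u = (a cos(ct+α), a sin(ct+α), c)`. -/
theorem nil_geodesic_flow_solution (a c α : ℝ) (hc : c ≠ 0) :
    let x : ℝ → ℝ := fun t => (2 * a / c) * Real.sin (c * t / 2) * Real.cos (c * t / 2 + α)
    let y : ℝ → ℝ := fun t => (2 * a / c) * Real.sin (c * t / 2) * Real.sin (c * t / 2 + α)
    let z : ℝ → ℝ := fun t => c * t + (a ^ 2 / (2 * c ^ 2)) * (c * t - Real.sin (c * t))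
    let ux : ℝ → ℝ := fun t => a * Real.cos (c * t + α)
    let uy : ℝ → ℝ := fun t => a * Real.sin (c * t + α)
    let uz : ℝ → ℝ := fun _ => c
    (∀ t, HasDerivAt x (ux t) t) ∧
    (∀ t, HasDerivAt y (uy t) t) ∧
    (∀ t, HasDerivAt z (uz t + (1 / 2) * (x t * uy t - y t * ux t)) t) ∧
    x 0 = 0 ∧ y 0 = 0 ∧ z 0 = 0 := by
  intro x y z ux uy uz
  have hlin (t : ℝ) : HasDerivAt (fun t : ℝ => c * t) c t := by
    simpa using (hasDerivAt_id t).const_mul c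
  have hhalf (t : ℝ) : HasDerivAt (fun t : ℝ => c * t / 2) (c / 2) t :=
    (hlin t).div_const 2
  have hdouble (t : ℝ) : c * t + α = c * t / 2 + (c * t / 2 + α) := by ring
  refine ⟨fun t => ?_, fun t => ?_, fun t => ?_, by simp [x], by simp [y], by simp [z]⟩
  · refine HasDerivAt.congr_deriv (((hhalf t).sin.const_mul (2 * a / c)).mul ((hhalf t).add_const α).cos) ?_
    simp only [ux]
    rw [hdouble, Real.cos_add (c * t / 2) (c * t / 2 + α)]
    field_simp
    ring
  · refine HasDerivAt.congr_deriv (((hhalf t).sin.const_mul (2 * a / c)).mul ((hhalf t).add_const α).sin) ?_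
    simp only [uy]
    rw [hdouble, Real.sin_add (c * t / 2) (c * t / 2 + α)]
    field_simp
    ring
  · refine HasDerivAt.congr_deriv ((hlin t).add (((hlin t).sub (hlin t).sin).const_mul (a ^ 2 / (2 * c ^ 2)))) ?_
    have hsub : Real.sin (c * t + α) * Real.cos (c * t / 2 + α)
        - Real.cos (c * t + α) * Real.sin (c * t / 2 + α) = Real.sin (c * t / 2) := by
      rw [← Real.sin_sub]
      ring_nf
    have hcos : Real.cos (c * t) = 1 - 2 * Real.sin (c * t / 2) ^ 2 := by
      rw [show c * t = 2 * (c * t / 2) by ring, Real.cos_two_mul, Real.cos_sq']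
      ring_nf
    symm
    calc uz t + (1 / 2) * (x t * uy t - y t * ux t)
        = c + a ^ 2 / c * Real.sin (c * t / 2) *
            (Real.sin (c * t + α) * Real.cos (c * t / 2 + α)
              - Real.cos (c * t + α) * Real.sin (c * t / 2 + α)) := by
          simp only [x, y, ux, uy, uz]
          ring
      _ = c + a ^ 2 / (2 * c ^ 2) * (c - Real.cos (c * t) * c) := by
          rw [hsub, hcos]
          field_simp
          ring
end

section
/- For a C¹ path γ = (x, y, z) : [0, T] → ℝ³, define its Nil length L(γ) = ∫₀ᵀ √( ẋ(t)² + ẏ(t)² + (ż(t) − ½(x(t)·ẏ(t) − y(t)·ẋ(t)))² ) dt. Let S be a nonempty subset of ℝ². Then the infimum, over all T > 0 and all C¹ paths γ : [0,T] → ℝ³ with γ(0) = (0,0,0) and (x(T), y(T)) ∈ S, of L(γ), equals the euclidean distance infDist((0,0), S) from the origin of ℝ² to S. -/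
open Set

/-- The Nil length of a path `γ : [0, T] → ℝ³` in the rotation-invariant model,
computed with derivatives within `[0, T]`. -/
noncomputable def nilLength (γ : ℝ → ℝ × ℝ × ℝ) (T : ℝ) : ℝ :=
  ∫ t in (0 : ℝ)..T,
    Real.sqrt
      ((derivWithin (fun s => (γ s).1) (Icc 0 T) t) ^ 2 +
        (derivWithin (fun s => (γ s).2.1) (Icc 0 T) t) ^ 2 +
        (derivWithin (fun s => (γ s).2.2) (Icc 0 T) t -
            (1 / 2) * ((γ t).1 * derivWithin (fun s => (γ s).2.1) (Icc 0 T) t -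
              (γ t).2.1 * derivWithin (fun s => (γ s).1) (Icc 0 T) t)) ^ 2)

open intervalIntegral in
/-- The fundamental theorem of calculus for `derivWithin` on a compact interval. -/
theorem integral_derivWithin_Icc_eq_sub {f : ℝ → ℝ} {T : ℝ} (hT : 0 < T)
    (hf : ContDiffOn ℝ 1 f (Icc 0 T)) :
    ∫ t in (0 : ℝ)..T, derivWithin f (Icc 0 T) t = f T - f 0 := by
  have hc : ContinuousOn (derivWithin f (Icc 0 T)) (Icc 0 T) :=
    hf.continuousOn_derivWithin (uniqueDiffOn_Icc hT) le_rfl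
  refine integral_eq_sub_of_hasDerivAt_of_le hT.le hf.continuousOn (fun t ht => ?_)
    (hc.intervalIntegrable_of_Icc hT.le)
  exact ((hf.differentiableOn one_ne_zero t (Ioo_subset_Icc_self ht)).hasDerivWithinAt).hasDerivAt
    (Icc_mem_nhds ht.1 ht.2)

theorem nilLength_nonneg (γ : ℝ → ℝ × ℝ × ℝ) {T : ℝ} (hT : 0 ≤ T) : 0 ≤ nilLength γ T :=
  intervalIntegral.integral_nonneg hT fun _ _ => Real.sqrt_nonneg _

theorem mul_add_mul_le_sqrt_mul_sqrt (a b u v w : ℝ) :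
    a * u + b * v ≤ Real.sqrt (a ^ 2 + b ^ 2) * Real.sqrt (u ^ 2 + v ^ 2 + w ^ 2) := by
  rw [← Real.sqrt_mul (by positivity)]
  refine Real.le_sqrt_of_sq_le ?_
  nlinarith [sq_nonneg (a * v - b * u), mul_nonneg (add_nonneg (sq_nonneg a) (sq_nonneg b))
    (sq_nonneg w)]

/-- The projection to the euclidean plane does not increase the length of a path from the origin:
the Nil length is at least the euclidean norm of the projected endpoint. -/
theorem sqrt_endpoint_le_nilLength {γ : ℝ → ℝ × ℝ × ℝ} {T : ℝ} (hT : 0 < T)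
    (hγ : ContDiffOn ℝ 1 γ (Icc 0 T)) (h0 : γ 0 = (0, 0, 0)) :
    Real.sqrt ((γ T).1 ^ 2 + (γ T).2.1 ^ 2) ≤ nilLength γ T := by
  have hx : ContDiffOn ℝ 1 (fun s => (γ s).1) (Icc 0 T) := hγ.fst
  have hy : ContDiffOn ℝ 1 (fun s => (γ s).2.1) (Icc 0 T) := hγ.snd.fst
  have hz : ContDiffOn ℝ 1 (fun s => (γ s).2.2) (Icc 0 T) := hγ.snd.snd
  have hu := uniqueDiffOn_Icc hT
  have hx' := hx.continuousOn_derivWithin hu le_rfl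
  have hy' := hy.continuousOn_derivWithin hu le_rfl
  have hz' := hz.continuousOn_derivWithin hu le_rfl
  have hxi := hx'.intervalIntegrable_of_Icc (μ := MeasureTheory.volume) hT.le
  have hyi := hy'.intervalIntegrable_of_Icc (μ := MeasureTheory.volume) hT.le
  have hxc := hx.continuousOn
  have hyc := hy.continuousOn
  have hspeed := ContinuousOn.intervalIntegrable_of_Icc (μ := MeasureTheory.volume) hT.le
    (((hx'.pow 2).add (hy'.pow 2)).add
      ((hz'.sub (continuousOn_const (c := (1 / 2 : ℝ)) |>.mul
        ((hxc.mul hy').sub (hyc.mul hx')))).pow 2)).sqrt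
  set r := Real.sqrt ((γ T).1 ^ 2 + (γ T).2.1 ^ 2)
  have hrsq : r * r = (γ T).1 ^ 2 + (γ T).2.1 ^ 2 := Real.mul_self_sqrt (by positivity)
  have key : r * r ≤ r * nilLength γ T := by
    calc r * r = ∫ t in (0 : ℝ)..T, ((γ T).1 * derivWithin (fun s => (γ s).1) (Icc 0 T) t +
          (γ T).2.1 * derivWithin (fun s => (γ s).2.1) (Icc 0 T) t) := by
          rw [intervalIntegral.integral_add (hxi.const_mul _) (hyi.const_mul _),
            intervalIntegral.integral_const_mul, intervalIntegral.integral_const_mul,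
            integral_derivWithin_Icc_eq_sub hT hx, integral_derivWithin_Icc_eq_sub hT hy, hrsq, h0]
          ring
      _ ≤ r * nilLength γ T := by
          rw [nilLength, ← intervalIntegral.integral_const_mul]
          exact intervalIntegral.integral_mono_on hT.le
            ((hxi.const_mul _).add (hyi.const_mul _)) (hspeed.const_mul r)
            fun t _ => mul_add_mul_le_sqrt_mul_sqrt _ _ _ _ _
  rcases (Real.sqrt_nonneg _ : 0 ≤ r).eq_or_lt with h | h
  · exact h.ge.trans (nilLength_nonneg γ hT.le)
  · exact le_of_mul_le_mul_left key h

theorem nilLength_horizontal_segment (a b : ℝ) :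
    nilLength (fun t => (t * a, t * b, 0)) 1 = Real.sqrt (a ^ 2 + b ^ 2) := by
  have hd (c t : ℝ) (ht : t ∈ Icc (0 : ℝ) 1) :
      derivWithin (fun s : ℝ => s * c) (Icc 0 1) t = c := by
    simpa using ((hasDerivAt_id t).mul_const c).hasDerivWithinAt.derivWithin
      (uniqueDiffOn_Icc one_pos t ht)
  have hcongr : EqOn (fun t => Real.sqrt
      ((derivWithin (fun s : ℝ => s * a) (Icc 0 1) t) ^ 2 +
        (derivWithin (fun s : ℝ => s * b) (Icc 0 1) t) ^ 2 +
        (derivWithin (fun _ : ℝ => (0 : ℝ)) (Icc 0 1) t -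
            (1 / 2) * (t * a * derivWithin (fun s : ℝ => s * b) (Icc 0 1) t -
              t * b * derivWithin (fun s : ℝ => s * a) (Icc 0 1) t)) ^ 2))
      (fun _ => Real.sqrt (a ^ 2 + b ^ 2)) (uIcc 0 1) := by
    intro t ht
    rw [uIcc_of_le zero_le_one] at ht
    simp only [hd a t ht, hd b t ht, derivWithin_fun_const, Pi.zero_apply]
    ring_nf
  rw [nilLength, intervalIntegral.integral_congr hcongr]
  simp

/-- The Nil distance from the origin to the vertical object `π⁻¹(S)` equals the
euclidean distance from the origin of `ℝ²` to `S`. -/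
theorem nil_dist_to_vertical_object (S : Set (ℝ × ℝ)) (hS : S.Nonempty) :
    sInf { L : ℝ | ∃ T : ℝ, 0 < T ∧ ∃ γ : ℝ → ℝ × ℝ × ℝ,
        ContDiffOn ℝ 1 γ (Icc 0 T) ∧ γ 0 = (0, 0, 0) ∧
        ((γ T).1, (γ T).2.1) ∈ S ∧ L = nilLength γ T } =
      sInf ((fun q : ℝ × ℝ => Real.sqrt (q.1 ^ 2 + q.2 ^ 2)) '' S) := by
  have hsub : (fun q : ℝ × ℝ => Real.sqrt (q.1 ^ 2 + q.2 ^ 2)) '' S ⊆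
      { L : ℝ | ∃ T : ℝ, 0 < T ∧ ∃ γ : ℝ → ℝ × ℝ × ℝ,
        ContDiffOn ℝ 1 γ (Icc 0 T) ∧ γ 0 = (0, 0, 0) ∧
        ((γ T).1, (γ T).2.1) ∈ S ∧ L = nilLength γ T } := by
    rintro _ ⟨⟨a, b⟩, hq, rfl⟩
    refine ⟨1, one_pos, fun t => (t * a, t * b, 0), ?_, by simp, by simpa using hq,
      (nilLength_horizontal_segment a b).symm⟩
    exact ContDiff.contDiffOn (by fun_prop)
  refine le_antisymm (csInf_le_csInf ⟨0, ?_⟩ (hS.image _) hsub)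
    (le_csInf ((hS.image _).mono hsub) ?_)
  · rintro _ ⟨T, hT, γ, -, -, -, rfl⟩
    exact nilLength_nonneg γ hT.le
  · rintro _ ⟨T, hT, γ, hγ, h0, hS', rfl⟩
    refine csInf_le_of_le ⟨0, ?_⟩ (mem_image_of_mem _ hS') (sqrt_endpoint_le_nilLength hT hγ h0)
    rintro _ ⟨q, -, rfl⟩
    exact Real.sqrt_nonneg _
end

section
/- Fix ρ > 0 and z ∈ ℝ, and define χ(φ) = −z + φ + (ρ²/(8·sin²(φ/2)))·(φ − sin φ) for φ ∈ ℝ with sin(φ/2) ≠ 0. Then for every integer k ≥ 0, χ is strictly convex on the open interval (2kπ, 2kπ + 2π); moreover χ is strictly increasing on (0, 2π). -/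
open Real Set in
/-- The Cusa–Huygens inequality, on the whole positive half-line. -/
theorem three_mul_sin_lt_mul_two_add_cos {x : ℝ} (hx : 0 < x) :
    3 * sin x < x * (2 + cos x) := by
  have hsq := sin_sq_add_cos_sq x
  rcases le_or_gt 2 x with h2 | h2
  · have hc := neg_one_le_cos x
    nlinarith [sq_nonneg (13 * sin x - 12), sq_nonneg (3 * sin x - 2), sq_nonneg (2 * cos x + 1),
      mul_nonneg (sub_nonneg.2 h2) (by linarith : 0 ≤ 2 + cos x)]
  · have hpos : ∀ y : ℝ, 0 < 2 + cos y := fun y => by linarith [neg_one_le_cos y]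
    have hd : ∀ y : ℝ, HasDerivAt (fun t => t - 3 * sin t / (2 + cos t))
        ((1 - cos y) ^ 2 / (2 + cos y) ^ 2) y := fun y => by
      have h := (hasDerivAt_id y).sub (((hasDerivAt_sin y).const_mul 3).div
        ((hasDerivAt_cos y).const_add 2) (hpos y).ne')
      refine h.congr_deriv ?_
      have := (hpos y).ne'
      field_simp
      linear_combination -3 * sin_sq_add_cos_sq y
    have hmono : StrictMonoOn (fun t => t - 3 * sin t / (2 + cos t)) (Icc 0 2) := by
      refine strictMonoOn_of_deriv_pos (convex_Icc 0 2)
        (fun y _ => (hd y).continuousAt.continuousWithinAt) fun y hy => ?_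
      rw [interior_Icc] at hy
      have hlt : cos y < 1 := by
        have := cos_lt_cos_of_nonneg_of_le_pi le_rfl (by linarith [hy.2, pi_gt_three]) hy.1
        rwa [cos_zero] at this
      rw [(hd y).deriv]
      have := hpos y
      have := sub_pos.2 hlt
      positivity
    have h0 := hmono ⟨le_rfl, zero_le_two⟩ ⟨hx.le, h2.le⟩ hx
    simp only [sin_zero, mul_zero, zero_div, sub_zero, sub_pos] at h0
    exact (div_lt_iff₀ (hpos x)).1 h0

open Real in
theorem mul_cos_lt_sin {x : ℝ} (h0 : 0 < x) (hpi : x < π) : x * cos x < sin x := by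
  rcases lt_or_ge x (π / 2) with h | h
  · have hc : 0 < cos x := cos_pos_of_mem_Ioo ⟨by linarith, h⟩
    have := lt_tan h0 h
    rwa [tan_eq_sin_div_cos, lt_div_iff₀ hc] at this
  · have hc : cos x ≤ 0 := cos_nonpos_of_pi_div_two_le_of_le h (by linarith)
    nlinarith [sin_pos_of_pos_of_lt_pi h0 hpi]

open Real in
theorem eight_mul_sin_half_sq (x : ℝ) : 8 * sin (x / 2) ^ 2 = 4 * (1 - cos x) := by
  rw [sin_sq_eq_half_sub, mul_div_cancel₀ x two_ne_zero]
  ring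

open Real in
theorem hasDerivAt_nil_chi (ρ z : ℝ) {x : ℝ} (hx : cos x < 1) :
    HasDerivAt (fun φ => -z + φ + (ρ ^ 2 / (8 * sin (φ / 2) ^ 2)) * (φ - sin φ))
      (1 + ρ ^ 2 / 4 * ((2 * (1 - cos x) - x * sin x) / (1 - cos x) ^ 2)) x := by
  have hne : 1 - cos x ≠ 0 := (sub_pos.2 hx).ne'
  have h := ((hasDerivAt_id x).const_add (-z)).add ((((hasDerivAt_id x).sub
    (hasDerivAt_sin x)).div ((hasDerivAt_cos x).const_sub 1) hne).const_mul (ρ ^ 2 / 4))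
  refine (h.congr_deriv ?_).congr_of_eventuallyEq (.of_forall fun φ => ?_)
  · simp only [Pi.sub_apply, id]
    congr 3
    linear_combination sin_sq_add_cos_sq x
  · simp only [eight_mul_sin_half_sq, Pi.add_apply, Pi.sub_apply, Pi.div_apply, id, ← div_div]
    ring

open Real in
theorem hasDerivAt_deriv_nil_chi (ρ : ℝ) {x : ℝ} (hx : cos x < 1) :
    HasDerivAt (fun φ => 1 + ρ ^ 2 / 4 * ((2 * (1 - cos φ) - φ * sin φ) / (1 - cos φ) ^ 2))
      (ρ ^ 2 / 4 * ((x * (2 + cos x) - 3 * sin x) / (1 - cos x) ^ 2)) x := by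
  have hne : 1 - cos x ≠ 0 := (sub_pos.2 hx).ne'
  have h1 := (hasDerivAt_cos x).const_sub 1
  have h := ((((h1.const_mul 2).sub ((hasDerivAt_id x).mul (hasDerivAt_sin x))).div
    (h1.pow 2) (pow_ne_zero 2 hne)).const_mul (ρ ^ 2 / 4)).const_add 1
  refine h.congr_deriv ?_
  simp only [Pi.sub_apply, Pi.mul_apply, Pi.pow_apply, id]
  congr 1
  field_simp
  push_cast
  linear_combination (2 * x * (1 - cos x)) * sin_sq_add_cos_sq x

open Real in
theorem cos_lt_one_of_mem_Ioo {k : ℕ} {x : ℝ}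
    (hx : x ∈ Set.Ioo (2 * k * π) (2 * k * π + 2 * π)) : cos x < 1 := by
  refine (cos_le_one x).lt_of_ne fun h => ?_
  obtain ⟨n, rfl⟩ := (cos_eq_one_iff x).1 h
  have h1 : (k : ℝ) < n := by nlinarith [hx.1, pi_pos]
  have h2 : (n : ℝ) < k + 1 := by nlinarith [hx.2, pi_pos]
  have h1' : (k : ℤ) < n := by exact_mod_cast h1
  have h2' : n < (k : ℤ) + 1 := by exact_mod_cast h2
  omega


/-- Convexity and monotonicity of the function `χ_{ρ,z}` whose zeros classify
the geodesics from the origin to a given point of Nil. -/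
theorem nil_chi_strictConvex_strictMono (ρ z : ℝ) (hρ : 0 < ρ) :
    let χ : ℝ → ℝ := fun φ =>
      -z + φ + (ρ ^ 2 / (8 * Real.sin (φ / 2) ^ 2)) * (φ - Real.sin φ)
    (∀ k : ℕ, StrictConvexOn ℝ
        (Set.Ioo (2 * k * Real.pi) (2 * k * Real.pi + 2 * Real.pi)) χ) ∧
    StrictMonoOn χ (Set.Ioo 0 (2 * Real.pi)) := by
  intro χ
  refine ⟨fun k => ?_, ?_⟩
  · refine strictConvexOn_of_deriv2_pos' (convex_Ioo _ _) (fun x hx =>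
      (hasDerivAt_nil_chi ρ z (cos_lt_one_of_mem_Ioo hx)).continuousAt.continuousWithinAt)
      fun x hx => ?_
    have hderiv : deriv χ =ᶠ[nhds x] fun φ => 1 + ρ ^ 2 / 4 *
        ((2 * (1 - Real.cos φ) - φ * Real.sin φ) / (1 - Real.cos φ) ^ 2) := by
      filter_upwards [isOpen_Ioo.mem_nhds hx] with y hy
      exact (hasDerivAt_nil_chi ρ z (cos_lt_one_of_mem_Ioo hy)).deriv
    have hcos := cos_lt_one_of_mem_Ioo hx
    have hx0 : 0 < x := lt_of_le_of_lt (by positivity) hx.1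
    rw [Function.iterate_succ_apply, Function.iterate_one, hderiv.deriv_eq,
      (hasDerivAt_deriv_nil_chi ρ hcos).deriv]
    have := sub_pos.2 (three_mul_sin_lt_mul_two_add_cos hx0)
    have := sub_pos.2 hcos
    positivity
  · have hcos : ∀ x ∈ Set.Ioo 0 (2 * Real.pi), Real.cos x < 1 := fun x hx =>
      cos_lt_one_of_mem_Ioo (k := 0) (by simpa using hx)
    refine strictMonoOn_of_deriv_pos (convex_Ioo _ _) (fun x hx =>
      (hasDerivAt_nil_chi ρ z (hcos x hx)).continuousAt.continuousWithinAt) fun x hx => ?_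
    rw [interior_Ioo] at hx
    rw [(hasDerivAt_nil_chi ρ z (hcos x hx)).deriv]
    have hnum : 0 < 2 * (1 - Real.cos x) - x * Real.sin x := by
      have hpos : 0 < x / 2 := by linarith [hx.1]
      have hlt : x / 2 < Real.pi := by linarith [hx.2]
      have hsin : Real.sin x = 2 * Real.sin (x / 2) * Real.cos (x / 2) := by
        rw [← Real.sin_two_mul, mul_div_cancel₀ x two_ne_zero]
      have := mul_pos (Real.sin_pos_of_pos_of_lt_pi hpos hlt)
        (sub_pos.2 (mul_cos_lt_sin hpos hlt))
      rw [hsin]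
      linarith [eight_mul_sin_half_sq x]
    have := sub_pos.2 (hcos x hx)
    positivity
end

section
/- Let z > 0 and let k ≥ 1 be an integer with 2kπ ≤ z. Set a = √((z − 2kπ)/(z − kπ)) and c = √(kπ/(z − kπ)). Then a² + c² = 1. Moreover, for every α ∈ ℝ, setting t_k = 2kπ·√(z/(kπ) − 1), the Nil geodesic formulas x(t) = (2a/c)·sin(c·t/2)·cos(c·t/2 + α), y(t) = (2a/c)·sin(c·t/2)·sin(c·t/2 + α), z(t) = c·t + (a²/(2c²))·(c·t − sin(c·t)), evaluated at t = t_k, satisfy x(t_k) = 0, y(t_k) = 0, and z(t_k) = z. -/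
/-- For `z > 0` and an integer `k ≥ 1` with `2kπ ≤ z`, the Nil geodesic with
initial data `a = √((z−2kπ)/(z−kπ))`, `c = √(kπ/(z−kπ))` (which satisfy
`a² + c² = 1`), flowed for time `t_k = 2kπ√(z/(kπ) − 1)`, reaches the point
`(0, 0, z)` on the z-axis, for every angle `α`. -/
theorem nil_geodesics_to_z_axis (z : ℝ) (hz0 : 0 < z) (k : ℕ) (hk : 1 ≤ k)
    (hz : 2 * k * Real.pi ≤ z) (α : ℝ) :
    let a : ℝ := Real.sqrt ((z - 2 * k * Real.pi) / (z - k * Real.pi))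
    let c : ℝ := Real.sqrt ((k * Real.pi) / (z - k * Real.pi))
    let tk : ℝ := 2 * k * Real.pi * Real.sqrt (z / (k * Real.pi) - 1)
    a ^ 2 + c ^ 2 = 1 ∧
    (2 * a / c) * Real.sin (c * tk / 2) * Real.cos (c * tk / 2 + α) = 0 ∧
    (2 * a / c) * Real.sin (c * tk / 2) * Real.sin (c * tk / 2 + α) = 0 ∧
    c * tk + (a ^ 2 / (2 * c ^ 2)) * (c * tk - Real.sin (c * tk)) = z := by
  intro a c tk
  have hp : 0 < k * Real.pi := mul_pos (by exact_mod_cast hk) Real.pi_pos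
  have hd : 0 < z - k * Real.pi := by linarith
  have ha : a ^ 2 = (z - 2 * k * Real.pi) / (z - k * Real.pi) :=
    Real.sq_sqrt (div_nonneg (by linarith) hd.le)
  have hc : c ^ 2 = (k * Real.pi) / (z - k * Real.pi) :=
    Real.sq_sqrt (div_nonneg hp.le hd.le)
  have hprod : (k * Real.pi) / (z - k * Real.pi) * (z / (k * Real.pi) - 1) = 1 := by
    rw [div_sub_one hp.ne', div_mul_div_cancel₀ hd.ne', div_self hp.ne']
  have hsqrt : c * Real.sqrt (z / (k * Real.pi) - 1) = 1 := by
    rw [← Real.sqrt_mul (div_nonneg hp.le hd.le), hprod, Real.sqrt_one]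
  have hct : c * tk = 2 * (k * Real.pi) := by
    linear_combination 2 * k * Real.pi * hsqrt
  have hsin_half : Real.sin (c * tk / 2) = 0 := by
    rw [hct, mul_div_cancel_left₀ _ two_ne_zero, Real.sin_nat_mul_pi]
  have hsin : Real.sin (c * tk) = 0 := by
    rw [hct, Real.sin_two_mul, Real.sin_nat_mul_pi, mul_zero, zero_mul]
  refine ⟨?_, by simp [hsin_half], by simp [hsin_half], ?_⟩
  · rw [ha, hc, ← add_div, div_eq_one_iff_eq hd.ne']
    ring
  · have hratio : a ^ 2 / (2 * c ^ 2) = (z - 2 * (k * Real.pi)) / (2 * (k * Real.pi)) := by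
      rw [ha, hc, ← mul_div_assoc, div_div_div_cancel_right₀ hd.ne', mul_assoc]
    rw [hsin, hratio, hct, sub_zero, div_mul_cancel₀ _ (by positivity)]
    ring
end

section
/- Let b, c ∈ ℝ with b² + c² = 1 and cosh(t) + c·sinh(t) > 0 for all t in the domain considered (which holds for all t ∈ ℝ when |c| < 1). Define u_x(t) = 0, u_y(t) = b/(cosh t + c·sinh t), u_z(t) = (c + tanh t)/(1 + c·tanh t), and x(t) = 0, y(t) = b·tanh t/(1 + c·tanh t), z(t) = log(cosh t + c·sinh t). Then for every t ∈ ℝ: (1) u_x has derivative u_x(t)·u_z(t) at t, u_y has derivative −u_y(t)·u_z(t) at t, and u_z has derivative u_y(t)² − u_x(t)² at t; and (2) x has derivative e^{z(t)}·u_x(t) at t, y has derivative e^{−z(t)}·u_y(t) at t, and z has derivative u_z(t) at t. Moreover (x(0), y(0), z(0)) = (0,0,0) and (u_x(0), u_y(0), u_z(0)) = (0, b, c). -/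
/-- Closed-form solution of the geodesic flow of Sol starting at the origin in
the direction `(0, b, c)`: the path stays in the totally geodesic hyperbolic
plane `{x = 0}` and solves the Grayson system together with the position
equations `ẋ = e^z uₓ, ẏ = e^{−z} u_y, ż = u_z`. -/
theorem sol_geodesic_flow_solution (b c : ℝ) (h : b ^ 2 + c ^ 2 = 1)
    (hpos : ∀ t : ℝ, 0 < Real.cosh t + c * Real.sinh t) :
    let ux : ℝ → ℝ := fun _ => 0
    let uy : ℝ → ℝ := fun t => b / (Real.cosh t + c * Real.sinh t)
    let uz : ℝ → ℝ := fun t => (c + Real.tanh t) / (1 + c * Real.tanh t)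
    let x : ℝ → ℝ := fun _ => 0
    let y : ℝ → ℝ := fun t => b * Real.tanh t / (1 + c * Real.tanh t)
    let z : ℝ → ℝ := fun t => Real.log (Real.cosh t + c * Real.sinh t)
    (∀ t, HasDerivAt ux (ux t * uz t) t) ∧
    (∀ t, HasDerivAt uy (-(uy t * uz t)) t) ∧
    (∀ t, HasDerivAt uz (uy t ^ 2 - ux t ^ 2) t) ∧
    (∀ t, HasDerivAt x (Real.exp (z t) * ux t) t) ∧
    (∀ t, HasDerivAt y (Real.exp (-z t) * uy t) t) ∧
    (∀ t, HasDerivAt z (uz t) t) ∧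
    x 0 = 0 ∧ y 0 = 0 ∧ z 0 = 0 ∧ ux 0 = 0 ∧ uy 0 = b ∧ uz 0 = c := by
  intro ux uy uz x y z
  have hne (t : ℝ) : Real.cosh t + c * Real.sinh t ≠ 0 := (hpos t).ne'
  have hch (t : ℝ) : Real.cosh t ≠ 0 := (Real.cosh_pos t).ne'
  have huz : uz = fun t => (Real.sinh t + c * Real.cosh t) /
      (Real.cosh t + c * Real.sinh t) := by
    funext t
    have h1 := hne t
    have h2 := hch t
    simp only [uz, Real.tanh_eq_sinh_div_cosh]
    field_simp
    ring
  have hy : y = fun t => b * Real.sinh t / (Real.cosh t + c * Real.sinh t) := by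
    funext t
    have h1 := hne t
    have h2 := hch t
    simp only [y, Real.tanh_eq_sinh_div_cosh]
    field_simp
  have hD (t : ℝ) : HasDerivAt (fun t => Real.cosh t + c * Real.sinh t)
      (Real.sinh t + c * Real.cosh t) t :=
    (Real.hasDerivAt_cosh t).add ((Real.hasDerivAt_sinh t).const_mul c)
  have hN (t : ℝ) : HasDerivAt (fun t => Real.sinh t + c * Real.cosh t)
      (Real.cosh t + c * Real.sinh t) t :=
    (Real.hasDerivAt_sinh t).add ((Real.hasDerivAt_cosh t).const_mul c)
  refine ⟨fun t => ?_, fun t => ?_, fun t => ?_, fun t => ?_, fun t => ?_, fun t => ?_,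
    rfl, by simp [y], by simp [z], rfl, by simp [uy], by simp [uz]⟩
  · simpa [ux] using hasDerivAt_const t (0 : ℝ)
  · have h1 := hne t
    refine ((hasDerivAt_const t b).div (hD t) h1).congr_deriv ?_
    simp only [huz, uy]
    field_simp
    ring
  · have h1 := hne t
    rw [huz]
    refine ((hN t).div (hD t) h1).congr_deriv ?_
    simp only [ux, uy]
    rw [div_pow, zero_pow two_ne_zero, sub_zero]
    congr 1
    linear_combination (1 - c ^ 2) * Real.cosh_sq_sub_sinh_sq t - h
  · simpa [x, ux] using hasDerivAt_const t (0 : ℝ)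
  · have h1 := hne t
    rw [hy]
    refine (((Real.hasDerivAt_sinh t).const_mul b).div (hD t) h1).congr_deriv ?_
    simp only [z, uy]
    rw [Real.exp_neg, Real.exp_log (hpos t)]
    field_simp
    linear_combination b * Real.cosh_sq_sub_sinh_sq t
  · rw [huz]
    exact (hD t).log (hne t)
end

section
/- For a C¹ path γ = (x, y, z) : [0, T] → ℝ³, define its Sol length L(γ) = ∫₀ᵀ √( e^{−2z(t)}·ẋ(t)² + e^{2z(t)}·ẏ(t)² + ż(t)² ) dt. Let p = (x₀, y₀, z₀) ∈ ℝ³ and α ∈ ℝ with x₀ ≤ α. Then the infimum, over all T > 0 and all C¹ paths γ : [0,T] → ℝ³ with γ(0) = p and x(T) ≥ α, of L(γ), equals arcsinh((α − x₀)·e^{−z₀}). -/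
open Set

/-- The Sol length of a path `γ : [0, T] → ℝ³`, computed with derivatives
within `[0, T]`. -/
noncomputable def solLength (γ : ℝ → ℝ × ℝ × ℝ) (T : ℝ) : ℝ :=
  ∫ t in (0 : ℝ)..T,
    Real.sqrt
      (Real.exp (-(2 * (γ t).2.2)) * (derivWithin (fun s => (γ s).1) (Icc 0 T) t) ^ 2 +
        Real.exp (2 * (γ t).2.2) * (derivWithin (fun s => (γ s).2.1) (Icc 0 T) t) ^ 2 +
        (derivWithin (fun s => (γ s).2.2) (Icc 0 T) t) ^ 2)

/-- The length of a path bounds the decrease of `arsinh ((α - x) * exp (-z))` along it. -/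
lemma arsinh_sub_arsinh_le_solLength {γ : ℝ → ℝ × ℝ × ℝ} {T : ℝ} (α : ℝ) (hT : 0 < T)
    (hγ : ContDiffOn ℝ 1 γ (Icc 0 T)) :
    Real.arsinh ((α - (γ 0).1) * Real.exp (-(γ 0).2.2)) -
      Real.arsinh ((α - (γ T).1) * Real.exp (-(γ T).2.2)) ≤ solLength γ T := by
  have hx : ContDiffOn ℝ 1 (fun s => (γ s).1) (Icc 0 T) := hγ.fst
  have hy : ContDiffOn ℝ 1 (fun s => (γ s).2.1) (Icc 0 T) := hγ.snd.fst
  have hz : ContDiffOn ℝ 1 (fun s => (γ s).2.2) (Icc 0 T) := hγ.snd.snd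
  have hU := uniqueDiffOn_Icc hT
  have hx' := hx.continuousOn_derivWithin hU le_rfl
  have hy' := hy.continuousOn_derivWithin hU le_rfl
  have hz' := hz.continuousOn_derivWithin hU le_rfl
  have hxc := hx.continuousOn
  have hzc := hz.continuousOn
  have hderiv : ∀ f : ℝ → ℝ, ContDiffOn ℝ 1 f (Icc 0 T) → ∀ t ∈ Ioo 0 T,
      HasDerivAt f (derivWithin f (Icc 0 T) t) t := fun f hf t ht =>
    ((hf.differentiableOn one_ne_zero t (Ioo_subset_Icc_self ht)).hasDerivWithinAt).hasDerivAt
      (Icc_mem_nhds ht.1 ht.2)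
  have key := intervalIntegral.sub_le_integral_of_hasDeriv_right_of_le (a := 0) (b := T)
    (g := fun t => -Real.arsinh ((α - (γ t).1) * Real.exp (-(γ t).2.2)))
    (g' := fun t => -((√(1 + ((α - (γ t).1) * Real.exp (-(γ t).2.2)) ^ 2))⁻¹ *
      (-derivWithin (fun s => (γ s).1) (Icc 0 T) t * Real.exp (-(γ t).2.2) +
        (α - (γ t).1) * (Real.exp (-(γ t).2.2) *
          -derivWithin (fun s => (γ s).2.2) (Icc 0 T) t))))
    (φ := fun t => Real.sqrt
      (Real.exp (-(2 * (γ t).2.2)) * (derivWithin (fun s => (γ s).1) (Icc 0 T) t) ^ 2 +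
        Real.exp (2 * (γ t).2.2) * (derivWithin (fun s => (γ s).2.1) (Icc 0 T) t) ^ 2 +
        (derivWithin (fun s => (γ s).2.2) (Icc 0 T) t) ^ 2))
    hT.le ?_ ?_ ?_ ?_
  · unfold solLength
    linarith
  · exact (Real.continuous_arsinh.comp_continuousOn (by fun_prop)).neg
  · intro t ht
    exact (((((hderiv _ hx t ht).const_sub α).mul
      (hderiv _ hz t ht).neg.exp).arsinh).neg).hasDerivWithinAt
  · exact ContinuousOn.integrableOn_Icc (by fun_prop)
  · intro t _
    generalize derivWithin (fun s => (γ s).1) (Icc 0 T) t = a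
    generalize derivWithin (fun s => (γ s).2.1) (Icc 0 T) t = b
    generalize derivWithin (fun s => (γ s).2.2) (Icc 0 T) t = c
    have he : Real.exp (-(2 * (γ t).2.2)) = Real.exp (-(γ t).2.2) ^ 2 := by
      rw [← Real.exp_nat_mul]; congr 1; push_cast; ring
    have hb : 0 ≤ Real.exp (2 * (γ t).2.2) * b ^ 2 := by positivity
    rw [he]
    generalize Real.exp (2 * (γ t).2.2) * b ^ 2 = B at hb ⊢
    generalize Real.exp (-(γ t).2.2) = e
    generalize α - (γ t).1 = d
    have hpos : 0 < 1 + (d * e) ^ 2 := by positivity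
    have heq : -((√(1 + (d * e) ^ 2))⁻¹ * (-a * e + d * (e * -c))) =
        (e * a + d * e * c) / √(1 + (d * e) ^ 2) := by
      ring
    rw [heq, div_le_iff₀ (Real.sqrt_pos.2 hpos), ← Real.sqrt_mul (by positivity)]
    apply Real.le_sqrt_of_sq_le
    nlinarith [sq_nonneg (e * a * (d * e) - c), mul_nonneg hb hpos.le]

/-- The circular arc that realizes the distance from `(x₀, y₀, z₀)` to `{x ≥ α}`, parametrized
proportionally to arc length by `[0, 1]`. -/
noncomputable def solArc (x₀ y₀ z₀ α t : ℝ) : ℝ × ℝ × ℝ :=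
  let s := Real.arsinh ((α - x₀) * Real.exp (-z₀))
  (α - Real.exp z₀ * Real.cosh s * (Real.sinh (s * (1 - t)) / Real.cosh (s * (1 - t))), y₀,
    z₀ + Real.log (Real.cosh s) - Real.log (Real.cosh (s * (1 - t))))

lemma solArc_zero (x₀ y₀ z₀ α : ℝ) : solArc x₀ y₀ z₀ α 0 = (x₀, y₀, z₀) := by
  have h : Real.exp z₀ * Real.exp (-z₀) = 1 := by rw [← Real.exp_add]; simp
  simp only [solArc, sub_zero, mul_one, Prod.mk.injEq, true_and]
  refine ⟨?_, by ring⟩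
  rw [mul_assoc, mul_div_cancel₀ _ (Real.cosh_pos _).ne', Real.sinh_arsinh]
  linear_combination (x₀ - α) * h

lemma solArc_one_fst (x₀ y₀ z₀ α : ℝ) : (solArc x₀ y₀ z₀ α 1).1 = α := by
  simp [solArc]

lemma contDiff_solArc (x₀ y₀ z₀ α : ℝ) : ContDiff ℝ 1 (solArc x₀ y₀ z₀ α) := by
  unfold solArc
  have hs (s : ℝ) : ContDiff ℝ 1 fun t : ℝ => s * (1 - t) := by fun_prop
  have hne (s : ℝ) : ∀ t : ℝ, Real.cosh (s * (1 - t)) ≠ 0 := fun t => (Real.cosh_pos _).ne'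
  exact (contDiff_const.sub (contDiff_const.mul ((hs _).sinh.div (hs _).cosh (hne _)))).prodMk
    (contDiff_const.prodMk (contDiff_const.sub ((hs _).cosh.log (hne _))))

lemma solLength_solArc (x₀ y₀ z₀ : ℝ) {α : ℝ} (hx : x₀ ≤ α) :
    solLength (solArc x₀ y₀ z₀ α) 1 = Real.arsinh ((α - x₀) * Real.exp (-z₀)) := by
  have hs : 0 ≤ Real.arsinh ((α - x₀) * Real.exp (-z₀)) :=
    Real.arsinh_nonneg_iff.2 (mul_nonneg (sub_nonneg.2 hx) (Real.exp_pos _).le)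
  unfold solLength solArc
  generalize Real.arsinh ((α - x₀) * Real.exp (-z₀)) = s at hs ⊢
  dsimp only
  trans ∫ _ in (0 : ℝ)..1, s
  swap
  · simp
  refine intervalIntegral.integral_congr fun t ht => ?_
  rw [uIcc_of_le zero_le_one] at ht
  have hU := uniqueDiffOn_Icc (zero_lt_one' ℝ) t ht
  have hl : HasDerivAt (fun t : ℝ => s * (1 - t)) (-s) t := by
    simpa using ((hasDerivAt_id t).const_sub 1).const_mul s
  have hc := Real.cosh_pos (s * (1 - t))
  have hc₀ := Real.cosh_pos s
  have hdx := (((hl.sinh.div hl.cosh hc.ne').const_mul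
    (Real.exp z₀ * Real.cosh s)).const_sub α).hasDerivWithinAt (s := Icc 0 1) |>.derivWithin hU
  have hdz := ((hl.cosh.log hc.ne').const_sub
    (z₀ + Real.log (Real.cosh s))).hasDerivWithinAt (s := Icc 0 1) |>.derivWithin hU
  simp only [Pi.div_apply] at hdx
  have he : Real.exp (-(2 * (z₀ + Real.log (Real.cosh s) - Real.log (Real.cosh (s * (1 - t)))))) =
      (Real.cosh (s * (1 - t)) / (Real.exp z₀ * Real.cosh s)) ^ 2 := by
    have : -(2 * (z₀ + Real.log (Real.cosh s) - Real.log (Real.cosh (s * (1 - t))))) =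
      (2 : ℕ) * (Real.log (Real.cosh (s * (1 - t))) - (z₀ + Real.log (Real.cosh s))) := by
      push_cast; ring
    rw [this, Real.exp_nat_mul, Real.exp_sub, Real.exp_add, Real.exp_log hc, Real.exp_log hc₀]
  simp only [hdx, hdz, he, derivWithin_fun_const, Pi.zero_apply]
  rw [Real.sqrt_eq_iff_eq_sq (by positivity) hs]
  have hsq := Real.cosh_sq (s * (1 - t))
  have hnum : Real.cosh (s * (1 - t)) * -s * Real.cosh (s * (1 - t)) -
      Real.sinh (s * (1 - t)) * (Real.sinh (s * (1 - t)) * -s) = -s := by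
    linear_combination -s * hsq
  rw [hnum]
  have hE := Real.exp_pos z₀
  field_simp
  linear_combination -s ^ 2 * hsq

/-- The Sol distance from `p = (x₀, y₀, z₀)` (with `x₀ ≤ α`) to the half-space
`{x ≥ α}` bounded by a hyperbolic plane equals `arcsinh((α − x₀)e^{−z₀})`. -/
theorem sol_dist_to_hyperbolic_halfspace (x₀ y₀ z₀ α : ℝ) (hx : x₀ ≤ α) :
    sInf { L : ℝ | ∃ T : ℝ, 0 < T ∧ ∃ γ : ℝ → ℝ × ℝ × ℝ,
        ContDiffOn ℝ 1 γ (Icc 0 T) ∧ γ 0 = (x₀, y₀, z₀) ∧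
        α ≤ (γ T).1 ∧ L = solLength γ T } =
      Real.arsinh ((α - x₀) * Real.exp (-z₀)) := by
  refine IsLeast.csInf_eq ⟨⟨1, one_pos, solArc x₀ y₀ z₀ α, (contDiff_solArc ..).contDiffOn,
    solArc_zero .., (solArc_one_fst ..).ge, (solLength_solArc _ _ _ hx).symm⟩, ?_⟩
  rintro _ ⟨T, hT, γ, hγ, h0, hα, rfl⟩
  have hlen := arsinh_sub_arsinh_le_solLength α hT hγ
  have hend : Real.arsinh ((α - (γ T).1) * Real.exp (-(γ T).2.2)) ≤ 0 :=
    Real.arsinh_nonpos_iff.2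
      (mul_nonpos_of_nonpos_of_nonneg (sub_nonpos.2 hα) (Real.exp_pos _).le)
  rw [h0] at hlen
  linarith
end

section
/- For a C¹ path γ = (x, y, z) : [0, T] → ℝ³, define its Sol length L(γ) = ∫₀ᵀ √( e^{−2z(t)}·ẋ(t)² + e^{2z(t)}·ẏ(t)² + ż(t)² ) dt. Let p = (x₀, y₀, z₀) ∈ ℝ³ and let c_x = {(t, 0, 0) : t ∈ ℝ} denote the x-axis. Then the infimum, over all T > 0 and all C¹ paths γ : [0,T] → ℝ³ with γ(0) = p and γ(T) ∈ c_x, of L(γ), equals d, where d ≥ 0 is characterized by cosh d = cosh z₀ + ½·e^{z₀}·y₀²; that is, the infimum equals arccosh(cosh z₀ + ½·e^{z₀}·y₀²). -/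
open Set

/-- The coordinates `(e^z y, sinh z - e^z y² / 2)` of the hyperboloid model of the plane `{x = 0}`,
paired with the direction `(a, b)`. -/
noncomputable def hyperboloidPairing (a b y z : ℝ) : ℝ :=
  a * (Real.exp z * y) + b * (Real.sinh z - Real.exp z * y ^ 2 / 2)

lemma exists_polar (u v : ℝ) :
    ∃ a b r : ℝ, 0 ≤ r ∧ a ^ 2 + b ^ 2 = 1 ∧ u = a * r ∧ v = b * r := by
  refine ⟨Real.cos (Complex.arg ⟨u, v⟩), Real.sin (Complex.arg ⟨u, v⟩), ‖(⟨u, v⟩ : ℂ)‖,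
    norm_nonneg _, Real.cos_sq_add_sin_sq _, ?_, ?_⟩
  · rw [mul_comm, Complex.norm_mul_cos_arg]
  · rw [mul_comm, Complex.norm_mul_sin_arg]

lemma sq_add_sq_hyperboloid (y z : ℝ) :
    1 + ((Real.exp z * y) ^ 2 + (Real.sinh z - Real.exp z * y ^ 2 / 2) ^ 2) =
      (Real.cosh z + (1 / 2) * Real.exp z * y ^ 2) ^ 2 := by
  have h := Real.cosh_sq z
  have e := Real.cosh_add_sinh z
  rw [← e]
  linear_combination -h

lemma hasDerivWithinAt_hyperboloidPairing {a b t y' z' : ℝ} {y z : ℝ → ℝ} {s : Set ℝ}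
    (hy : HasDerivWithinAt y y' s t) (hz : HasDerivWithinAt z z' s t) :
    HasDerivWithinAt (fun t => hyperboloidPairing a b (y t) (z t))
      (Real.exp (z t) * (a - b * y t) * y' +
        (a * Real.exp (z t) * y t + b * (Real.cosh (z t) - Real.exp (z t) * y t ^ 2 / 2)) * z')
      s t := by
  unfold hyperboloidPairing
  refine (((hz.exp.fun_mul hy).const_mul a).fun_add
    ((hz.sinh.fun_sub ((hz.exp.fun_mul (hy.fun_pow 2)).div_const 2)).const_mul b)).congr_deriv ?_
  push_cast
  ring

lemma neg_deriv_hyperboloidPairing_le {a b : ℝ} (hab : a ^ 2 + b ^ 2 = 1) (y z x' y' z' : ℝ) :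
    -(Real.exp z * (a - b * y) * y' +
        (a * Real.exp z * y + b * (Real.cosh z - Real.exp z * y ^ 2 / 2)) * z') ≤
      √(1 + hyperboloidPairing a b y z ^ 2) *
        √(Real.exp (-(2 * z)) * x' ^ 2 + Real.exp (2 * z) * y' ^ 2 + z' ^ 2) := by
  set m := a * Real.exp z * y + b * (Real.cosh z - Real.exp z * y ^ 2 / 2) with hm
  have e2 : Real.exp (2 * z) = Real.exp z ^ 2 := by rw [two_mul, Real.exp_add, sq]
  have hgrad : 1 + hyperboloidPairing a b y z ^ 2 = (a - b * y) ^ 2 + m ^ 2 := by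
    rw [hyperboloidPairing, hm, ← Real.cosh_add_sinh z]
    linear_combination -hab - (b ^ 2 + 2 * a * b * y - b ^ 2 * y ^ 2) * Real.cosh_sq z
  rw [← Real.sqrt_mul (by positivity)]
  refine Real.le_sqrt_of_sq_le ?_
  rw [hgrad, e2]
  have hx : 0 ≤ ((a - b * y) ^ 2 + m ^ 2) * (Real.exp (-(2 * z)) * x' ^ 2) := by positivity
  nlinarith [sq_nonneg ((a - b * y) * z' - m * (Real.exp z * y'))]

lemma arsinh_hyperboloidPairing_le_solLength {a b T : ℝ} (hab : a ^ 2 + b ^ 2 = 1) (hT : 0 < T)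
    {γ : ℝ → ℝ × ℝ × ℝ} (hγ : ContDiffOn ℝ 1 γ (Icc 0 T)) (hy : (γ T).2.1 = 0)
    (hz : (γ T).2.2 = 0) :
    Real.arsinh (hyperboloidPairing a b (γ 0).2.1 (γ 0).2.2) ≤ solLength γ T := by
  have cx : ContDiffOn ℝ 1 (fun s => (γ s).1) (Icc 0 T) := hγ.fst
  have cy : ContDiffOn ℝ 1 (fun s => (γ s).2.1) (Icc 0 T) := hγ.snd.fst
  have cz : ContDiffOn ℝ 1 (fun s => (γ s).2.2) (Icc 0 T) := hγ.snd.snd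
  have hu : UniqueDiffOn ℝ (Icc 0 T) := uniqueDiffOn_Icc hT
  have dx := cx.continuousOn_derivWithin hu le_rfl
  have dy := cy.continuousOn_derivWithin hu le_rfl
  have dz := cz.continuousOn_derivWithin hu le_rfl
  have zc := cz.continuousOn
  have hder : ∀ t ∈ Icc 0 T, HasDerivWithinAt
      (fun t => -Real.arsinh (hyperboloidPairing a b (γ t).2.1 (γ t).2.2)) _ (Icc 0 T) t :=
    fun t ht => (hasDerivWithinAt_hyperboloidPairing
      ((cy.differentiableOn one_ne_zero t ht).hasDerivWithinAt)
      ((cz.differentiableOn one_ne_zero t ht).hasDerivWithinAt)).arsinh.fun_neg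
  have key := intervalIntegral.sub_le_integral_of_hasDeriv_right_of_le hT.le
    (fun t ht => (hder t ht).continuousWithinAt)
    (fun t ht => ((hder t (Ioo_subset_Icc_self ht)).hasDerivAt
      (Icc_mem_nhds ht.1 ht.2)).hasDerivWithinAt)
    (φ := fun t => √(Real.exp (-(2 * (γ t).2.2)) *
        (derivWithin (fun s => (γ s).1) (Icc 0 T) t) ^ 2 +
        Real.exp (2 * (γ t).2.2) * (derivWithin (fun s => (γ s).2.1) (Icc 0 T) t) ^ 2 +
        (derivWithin (fun s => (γ s).2.2) (Icc 0 T) t) ^ 2))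
    (ContinuousOn.integrableOn_Icc (by fun_prop))
    (fun t _ => by
      rw [smul_eq_mul, ← mul_neg, inv_mul_le_iff₀ (by positivity)]
      exact neg_deriv_hyperboloidPairing_le hab _ _ _ _ _)
  simpa [hy, hz, hyperboloidPairing, solLength] using key

lemma cosh_add_mul_sinh_pos {b : ℝ} (hb : b ^ 2 ≤ 1) (s : ℝ) :
    0 < Real.cosh s + b * Real.sinh s := by
  have hb' := abs_le.1 ((sq_le_one_iff_abs_le_one b).1 hb)
  rw [Real.cosh_eq, Real.sinh_eq]
  have h1 := Real.exp_pos s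
  have h2 := Real.exp_pos (-s)
  rcases le_total b 0 with h | h <;> nlinarith

/-- The geodesic of the plane `{x = x₀}` reaching `(x₀, 0, 0)` at time `1` with speed `d`. -/
noncomputable def solGeodesic (x₀ a b d : ℝ) (t : ℝ) : ℝ × ℝ × ℝ :=
  (x₀, a * Real.sinh (d * (1 - t)) /
      (Real.cosh (d * (1 - t)) + b * Real.sinh (d * (1 - t))),
    Real.log (Real.cosh (d * (1 - t)) + b * Real.sinh (d * (1 - t))))

lemma contDiff_solGeodesic {b : ℝ} (hb : b ^ 2 ≤ 1) (x₀ a d : ℝ) :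
    ContDiff ℝ 1 (solGeodesic x₀ a b d) := by
  have hs : ContDiff ℝ 1 fun t : ℝ => Real.sinh (d * (1 - t)) :=
    (contDiff_const.mul (contDiff_const.sub contDiff_id)).sinh
  have hc : ContDiff ℝ 1 fun t : ℝ => Real.cosh (d * (1 - t)) :=
    (contDiff_const.mul (contDiff_const.sub contDiff_id)).cosh
  have he := hc.add (contDiff_const (c := b) |>.mul hs)
  have hne := fun t => (cosh_add_mul_sinh_pos hb (d * (1 - t))).ne'
  exact contDiff_const.prodMk (((contDiff_const.mul hs).div he hne).prodMk (he.log hne))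

lemma solLength_solGeodesic {a b d : ℝ} (hab : a ^ 2 + b ^ 2 = 1) (hd : 0 ≤ d) (x₀ : ℝ) :
    solLength (solGeodesic x₀ a b d) 1 = d := by
  have hb : b ^ 2 ≤ 1 := by nlinarith [sq_nonneg a]
  have hspeed : ∀ t ∈ uIcc (0 : ℝ) 1, √(Real.exp (-(2 * (solGeodesic x₀ a b d t).2.2)) *
        (derivWithin (fun s => (solGeodesic x₀ a b d s).1) (Icc 0 1) t) ^ 2 +
      Real.exp (2 * (solGeodesic x₀ a b d t).2.2) *
        (derivWithin (fun s => (solGeodesic x₀ a b d s).2.1) (Icc 0 1) t) ^ 2 +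
      (derivWithin (fun s => (solGeodesic x₀ a b d s).2.2) (Icc 0 1) t) ^ 2) = d := by
    intro t ht
    rw [uIcc_of_le zero_le_one] at ht
    have hu := uniqueDiffOn_Icc (zero_lt_one (α := ℝ)) t ht
    have hpos := cosh_add_mul_sinh_pos hb (d * (1 - t))
    have hl : HasDerivAt (fun t : ℝ => d * (1 - t)) (-d) t :=
      (((hasDerivAt_id t).const_sub 1).const_mul d).congr_deriv (by ring)
    have he := hl.cosh.fun_add (hl.sinh.const_mul b)
    have hy := ((hl.sinh.const_mul a).fun_div he hpos.ne').hasDerivWithinAt.derivWithin hu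
    have hz := (he.log hpos.ne').hasDerivWithinAt.derivWithin hu
    simp only [solGeodesic]
    rw [hy, hz, derivWithin_fun_const, two_mul, Real.exp_add, Real.exp_log hpos]
    have hcs := Real.cosh_sq (d * (1 - t))
    set c := Real.cosh (d * (1 - t))
    set s := Real.sinh (d * (1 - t))
    rw [Real.sqrt_eq_iff_mul_self_eq (by positivity) hd]
    simp only [Pi.zero_apply]
    have hn : -(c * (c + b * s)) - s * (-s + -(c * b)) = -1 := by linear_combination -hcs
    field_simp
    rw [hn]
    linear_combination d ^ 2 * hab - d ^ 2 * (1 - b ^ 2) * hcs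
  rw [solLength, intervalIntegral.integral_congr hspeed]
  simp

lemma solGeodesic_zero {a b d x₀ y₀ z₀ : ℝ} (hu : Real.exp z₀ * y₀ = a * Real.sinh d)
    (hv : Real.sinh z₀ - Real.exp z₀ * y₀ ^ 2 / 2 = b * Real.sinh d)
    (hd : Real.cosh d = Real.cosh z₀ + (1 / 2) * Real.exp z₀ * y₀ ^ 2) :
    solGeodesic x₀ a b d 0 = (x₀, y₀, z₀) := by
  have he : Real.cosh d + b * Real.sinh d = Real.exp z₀ := by
    rw [← hv, hd, ← Real.cosh_add_sinh z₀]; ring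
  simp only [solGeodesic, sub_zero, mul_one, he, ← hu, Real.log_exp]
  rw [mul_div_cancel_left₀ _ (Real.exp_ne_zero _)]

/-- The Sol distance from `p = (x₀, y₀, z₀)` to the x-axis `c_x = {(t,0,0)}`
is the number `d ≥ 0` characterized by `cosh d = cosh z₀ + ½ e^{z₀} y₀²`. -/
theorem sol_dist_to_x_axis (x₀ y₀ z₀ : ℝ) :
    0 ≤ sInf { L : ℝ | ∃ T : ℝ, 0 < T ∧ ∃ γ : ℝ → ℝ × ℝ × ℝ,
        ContDiffOn ℝ 1 γ (Icc 0 T) ∧ γ 0 = (x₀, y₀, z₀) ∧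
        (γ T).2.1 = 0 ∧ (γ T).2.2 = 0 ∧ L = solLength γ T } ∧
    Real.cosh (sInf { L : ℝ | ∃ T : ℝ, 0 < T ∧ ∃ γ : ℝ → ℝ × ℝ × ℝ,
        ContDiffOn ℝ 1 γ (Icc 0 T) ∧ γ 0 = (x₀, y₀, z₀) ∧
        (γ T).2.1 = 0 ∧ (γ T).2.2 = 0 ∧ L = solLength γ T }) =
      Real.cosh z₀ + (1 / 2) * Real.exp z₀ * y₀ ^ 2 := by
  obtain ⟨a, b, r, hr, hab, hu, hv⟩ :=
    exists_polar (Real.exp z₀ * y₀) (Real.sinh z₀ - Real.exp z₀ * y₀ ^ 2 / 2)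
  have hpair : hyperboloidPairing a b y₀ z₀ = r := by
    rw [hyperboloidPairing, hu, hv]
    linear_combination r * hab
  have hcosh : Real.cosh (Real.arsinh r) = Real.cosh z₀ + (1 / 2) * Real.exp z₀ * y₀ ^ 2 := by
    rw [Real.cosh_arsinh, Real.sqrt_eq_iff_mul_self_eq (by positivity) (by positivity), ← sq,
      ← sq_add_sq_hyperboloid, hu, hv]
    linear_combination -r ^ 2 * hab
  have hd : 0 ≤ Real.arsinh r := Real.arsinh_nonneg_iff.2 hr
  have hleast : IsLeast { L : ℝ | ∃ T : ℝ, 0 < T ∧ ∃ γ : ℝ → ℝ × ℝ × ℝ,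
      ContDiffOn ℝ 1 γ (Icc 0 T) ∧ γ 0 = (x₀, y₀, z₀) ∧
      (γ T).2.1 = 0 ∧ (γ T).2.2 = 0 ∧ L = solLength γ T } (Real.arsinh r) := by
    constructor
    · refine ⟨1, one_pos, solGeodesic x₀ a b (Real.arsinh r),
        (contDiff_solGeodesic (by nlinarith [sq_nonneg a]) _ _ _).contDiffOn,
        solGeodesic_zero ?_ ?_ hcosh, ?_, ?_, (solLength_solGeodesic hab hd x₀).symm⟩
      · rw [Real.sinh_arsinh, hu]
      · rw [Real.sinh_arsinh, hv]
      · simp [solGeodesic]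
      · simp [solGeodesic]
    · rintro L ⟨T, hT, γ, hγ, h0, hy, hz, rfl⟩
      simpa only [h0, hpair] using arsinh_hyperboloidPairing_le_solLength hab hT hγ hy hz
  rw [hleast.csInf_eq]
  exact ⟨hd, hcosh⟩
end
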